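/- arXiv:1810.07118 — 3 statements merged into one kernel-verified Lean document; each statement's English description precedes it below -/
import Mathlib

section
/- Fix natural numbers n, m, a horizon N, a dynamics map f : ℕ → ℝⁿ → ℝᵐ → ℝⁿ, an input set U ⊆ ℝᵐ, a bounded disturbance set E ⊆ ℝⁿ, and a target tube T_0,…,T_N ⊆ ℝⁿ. Then for every k < N, the disturbance minimal reach set satisfies the backward recursion R̲_k(E) = T_k ∩ { x ∈ ℝⁿ : ∃ u ∈ U such that for all e ∈ E, f_k(x,u) + e ∈ R̲_{k+1}(E) }, i.e. R̲_k(E) equals the intersection of T_k with the one-step backward reach set of the Minkowski (Pontryagin) difference R̲_{k+1}(E) ⊖ E. (No convexity, topological, or measurability assumptions on the sets are needed.) -/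
/-- Closed-loop trajectory: `traj f ν e k x j` is the state at time `k + j` of the system
`x_{t+1} = f_t(x_t, ν_t(x_t)) + e_t` started from state `x` at time `k`. -/
def traj {n m : ℕ} (f : ℕ → (Fin n → ℝ) → (Fin m → ℝ) → (Fin n → ℝ))
    (ν : ℕ → (Fin n → ℝ) → (Fin m → ℝ)) (e : ℕ → (Fin n → ℝ)) (k : ℕ) (x : Fin n → ℝ) :
    ℕ → (Fin n → ℝ)
  | 0 => x
  | j + 1 => f (k + j) (traj f ν e k x j) (ν (k + j) (traj f ν e k x j)) + e (k + j)

/-- The disturbance minimal reach set `R̲_k(E)` of the target tube `T_0, …, T_N`: states in `T_k`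
from which some admissible state-feedback policy keeps the trajectory in the tube for every
disturbance sequence with values in `E`. -/
def ReachMin {n m : ℕ} (N : ℕ) (f : ℕ → (Fin n → ℝ) → (Fin m → ℝ) → (Fin n → ℝ))
    (U : Set (Fin m → ℝ)) (E : Set (Fin n → ℝ)) (T : ℕ → Set (Fin n → ℝ)) (k : ℕ) :
    Set (Fin n → ℝ) :=
  { x | x ∈ T k ∧ ∃ ν : ℕ → (Fin n → ℝ) → (Fin m → ℝ),
      (∀ t z, ν t z ∈ U) ∧
      ∀ e : ℕ → (Fin n → ℝ), (∀ t, k ≤ t → t < N → e t ∈ E) →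
        ∀ j, k + j ≤ N → traj f ν e k x j ∈ T (k + j) }

theorem traj_shift {n m : ℕ} (f : ℕ → (Fin n → ℝ) → (Fin m → ℝ) → (Fin n → ℝ))
    (ν : ℕ → (Fin n → ℝ) → (Fin m → ℝ)) (e e' : ℕ → (Fin n → ℝ)) (k : ℕ) (x : Fin n → ℝ)
    (he : ∀ t, k + 1 ≤ t → e' t = e t) (j : ℕ) :
    traj f ν e (k + 1) (f k x (ν k x) + e' k) j = traj f ν e' k x (j + 1) := by
  induction j with
  | zero => simp [traj]
  | succ j ih =>
    rw [traj, ih, traj.eq_2 f ν e' k x (j + 1), ← he (k + 1 + j) (by omega),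
      show k + 1 + j = k + (j + 1) by omega]

theorem reachMin_step {n m : ℕ} (N : ℕ)
    (f : ℕ → (Fin n → ℝ) → (Fin m → ℝ) → (Fin n → ℝ))
    (U : Set (Fin m → ℝ)) (E : Set (Fin n → ℝ)) (T : ℕ → Set (Fin n → ℝ))
    (k : ℕ) (hk : k < N) (x : Fin n → ℝ) (hx : x ∈ ReachMin N f U E T k) :
    ∃ u ∈ U, ∀ e ∈ E, f k x u + e ∈ ReachMin N f U E T (k + 1) := by
  obtain ⟨_, ν, hν, h⟩ := hx
  refine ⟨ν k x, hν k x, fun a ha => ⟨?_, ν, hν, ?_⟩⟩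
  · have := h (fun _ => a) (fun _ _ _ => ha) 1 (by omega)
    simpa [traj] using this
  · intro e he j hj
    have h1 := h (Function.update e k a) (by
      intro t ht htN
      by_cases hkt : t = k
      · subst hkt; simpa using ha
      · rw [Function.update_of_ne hkt]; exact he t (by omega) htN) (j + 1) (by omega)
    have h2 := traj_shift f ν e (Function.update e k a) k x
      (fun t ht => Function.update_of_ne (by omega) _ _) j
    rw [Function.update_self] at h2
    rw [h2, show k + 1 + j = k + (j + 1) by omega]
    exact h1

/-- Backward recursion for the disturbance minimal reach set:
`R̲_k(E) = T_k ∩ { x : ∃ u ∈ U, ∀ e ∈ E, f_k(x,u) + e ∈ R̲_{k+1}(E) }`. -/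
theorem reachMin_backward_recursion {n m : ℕ} (N : ℕ)
    (f : ℕ → (Fin n → ℝ) → (Fin m → ℝ) → (Fin n → ℝ))
    (U : Set (Fin m → ℝ)) (E : Set (Fin n → ℝ)) (T : ℕ → Set (Fin n → ℝ))
    (k : ℕ) (hk : k < N) :
    ReachMin N f U E T k =
      T k ∩ { x | ∃ u ∈ U, ∀ e ∈ E, f k x u + e ∈ ReachMin N f U E T (k + 1) } := by
  classical
  ext x
  constructor
  · intro hx
    exact ⟨hx.1, reachMin_step N f U E T k hk x hx⟩
  · rintro ⟨hxT, hxS⟩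
    obtain ⟨u₀, hu₀, _⟩ := id hxS
    have key : ∀ t z, ∃ u ∈ U,
        (∃ u ∈ U, ∀ e ∈ E, f t z u + e ∈ ReachMin N f U E T (t + 1)) →
          ∀ e ∈ E, f t z u + e ∈ ReachMin N f U E T (t + 1) := by
      intro t z
      by_cases h : ∃ u ∈ U, ∀ e ∈ E, f t z u + e ∈ ReachMin N f U E T (t + 1)
      · obtain ⟨u, hu, h'⟩ := h
        exact ⟨u, hu, fun _ => h'⟩
      · exact ⟨u₀, hu₀, fun h' => absurd h' h⟩
    choose ν hν hstep using key
    refine ⟨hxT, ν, hν, fun e he => ?_⟩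
    have main : ∀ j, k + (j + 1) ≤ N →
        traj f ν e k x (j + 1) ∈ ReachMin N f U E T (k + (j + 1)) := by
      intro j
      induction j with
      | zero =>
        intro _
        exact hstep k x hxS (e k) (he k le_rfl hk)
      | succ j ih =>
        intro hj
        exact hstep (k + (j + 1)) _
          (reachMin_step N f U E T _ (by omega) _ (ih (by omega))) _
          (he _ (by omega) (by omega))
    intro j hj
    cases j with
    | zero => exact hxT
    | succ j => exact (main j hj).1
end

section
/- Let U ⊆ ℝᵐ be nonempty and compact, E ⊆ ℝⁿ be nonempty, f : ℕ → ℝⁿ → ℝᵐ → ℝⁿ be such that each f_k is continuous on ℝⁿ × ℝᵐ, and T_0,…,T_N ⊆ ℝⁿ be closed sets. Define g_k(x) = 0 if x ∈ T_k and g_k(x) = 1 otherwise, and define the min–max value functions J_N(x) = g_N(x) and, for k < N, J_k(x) = g_k(x) + inf_{u ∈ U} sup_{w ∈ E} J_{k+1}( f_k(x,u) + w ). Then for every k ∈ {0,…,N}: (i) J_k takes values in [0, N−k+1] (in particular all suprema and infima are over bounded sets of reals); (ii) J_k is lower semicontinuous on ℝⁿ; and (iii) for every x ∈ ℝⁿ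 the infimum over u ∈ U is attained, i.e. there exists u* ∈ U with J_k(x) = g_k(x) + sup_{w ∈ E} J_{k+1}( f_k(x,u*) + w ). -/
open scoped Classical

/-- Target-tube violation indicator: `gfun T k x = 0` if `x ∈ T_k` and `1` otherwise. -/
noncomputable def gfun {n : ℕ} (T : ℕ → Set (Fin n → ℝ)) (k : ℕ) (x : Fin n → ℝ) : ℝ :=
  if x ∈ T k then 0 else 1

/-- Auxiliary min–max value functions indexed by the number `d` of remaining steps:
`Jaux f U E T N d = J_{N−d}`, with `J_N = g_N` and
`J_k(x) = g_k(x) + inf_{u ∈ U} sup_{w ∈ E} J_{k+1}(f_k(x,u) + w)`. -/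
noncomputable def Jaux {n m : ℕ} (f : ℕ → (Fin n → ℝ) → (Fin m → ℝ) → (Fin n → ℝ))
    (U : Set (Fin m → ℝ)) (E : Set (Fin n → ℝ)) (T : ℕ → Set (Fin n → ℝ)) (N : ℕ) :
    ℕ → (Fin n → ℝ) → ℝ
  | 0 => gfun T N
  | d + 1 => fun x =>
      gfun T (N - (d + 1)) x +
        ⨅ u : U, ⨆ w : E, Jaux f U E T N d (f (N - (d + 1)) x u.1 + w.1)

/-- The min–max value function `J_k` of the reachability of a target tube problem. -/
noncomputable def Jval {n m : ℕ} (f : ℕ → (Fin n → ℝ) → (Fin m → ℝ) → (Fin n → ℝ))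
    (U : Set (Fin m → ℝ)) (E : Set (Fin n → ℝ)) (T : ℕ → Set (Fin n → ℝ)) (N k : ℕ) :
    (Fin n → ℝ) → ℝ :=
  Jaux f U E T N (N - k)

theorem lsc_min_attained {X K : Type*} [TopologicalSpace X] [TopologicalSpace K] [CompactSpace K]
    [Nonempty K] (F : X × K → ℝ) (hF : LowerSemicontinuous F) (h0 : ∀ p, 0 ≤ F p) :
    LowerSemicontinuous (fun x => ⨅ u, F (x, u)) ∧ ∀ x, ∃ u, ⨅ v, F (x, v) = F (x, u) := by
  have hatt : ∀ x, ∃ u, ⨅ v, F (x, v) = F (x, u) := by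
    intro x
    have h1 : LowerSemicontinuous (fun u => F (x, u)) :=
      hF.comp (g := fun u : K => (x, u)) (by fun_prop)
    obtain ⟨u, -, hu⟩ := LowerSemicontinuousOn.exists_isMinOn (s := Set.univ) Set.univ_nonempty
      isCompact_univ (h1.lowerSemicontinuousOn _)
    refine ⟨u, le_antisymm (ciInf_le ⟨0, ?_⟩ u) (le_ciInf fun v => hu (Set.mem_univ v))⟩
    rintro _ ⟨v, rfl⟩
    exact h0 _
  refine ⟨?_, hatt⟩
  rw [lowerSemicontinuous_iff_isClosed_preimage]
  intro y
  have := isClosedMap_fst_of_compactSpace (X := X) (Y := K) _ (hF.isClosed_preimage y)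
  convert this using 1
  ext x
  simp only [Set.mem_preimage, Set.mem_Iic, Set.mem_image, Prod.exists]
  constructor
  · intro h
    obtain ⟨u, hu⟩ := hatt x
    exact ⟨x, u, hu ▸ h, rfl⟩
  · rintro ⟨x', u, h, rfl⟩
    refine (ciInf_le ⟨0, ?_⟩ u).trans h
    rintro _ ⟨v, rfl⟩
    exact h0 _

theorem gfun_lsc {n : ℕ} (T : ℕ → Set (Fin n → ℝ)) (k : ℕ) (h : IsClosed (T k)) :
    LowerSemicontinuous (gfun T k) := by
  have := (h.isOpen_compl).lowerSemicontinuous_indicator (y := (1 : ℝ)) zero_le_one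
  convert this using 1
  ext x
  by_cases hx : x ∈ T k <;> simp [gfun, hx]

theorem gfun_mem {n : ℕ} (T : ℕ → Set (Fin n → ℝ)) (k : ℕ) (x : Fin n → ℝ) :
    0 ≤ gfun T k x ∧ gfun T k x ≤ 1 := by
  unfold gfun
  split_ifs <;> norm_num

theorem step_aux {n m : ℕ} (f : (Fin n → ℝ) → (Fin m → ℝ) → (Fin n → ℝ))
    (U : Set (Fin m → ℝ)) (E : Set (Fin n → ℝ))
    (hU : U.Nonempty) (hUc : IsCompact U) (hE : E.Nonempty)
    (hf : Continuous (fun p : (Fin n → ℝ) × (Fin m → ℝ) => f p.1 p.2))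
    (J : (Fin n → ℝ) → ℝ) (hJ : LowerSemicontinuous J) (c : ℝ)
    (hb : ∀ x, 0 ≤ J x ∧ J x ≤ c) :
    LowerSemicontinuous (fun x => ⨅ u : U, ⨆ w : E, J (f x u.1 + w.1)) ∧
    (∀ x, ∃ u : U, ⨅ u : U, ⨆ w : E, J (f x u.1 + w.1) = ⨆ w : E, J (f x u.1 + w.1)) ∧
    (∀ x, 0 ≤ (⨅ u : U, ⨆ w : E, J (f x u.1 + w.1)) ∧
      (⨅ u : U, ⨆ w : E, J (f x u.1 + w.1)) ≤ c) := by
  haveI := hU.to_subtype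
  haveI := hE.to_subtype
  haveI := isCompact_iff_compactSpace.mp hUc
  have h0 : ∀ p : (Fin n → ℝ) × U, 0 ≤ ⨆ w : E, J (f p.1 p.2.1 + w.1) :=
    fun p => Real.iSup_nonneg fun w => (hb _).1
  have hc : ∀ p : (Fin n → ℝ) × U, ⨆ w : E, J (f p.1 p.2.1 + w.1) ≤ c :=
    fun p => ciSup_le fun w => (hb _).2
  have hl : LowerSemicontinuous
      (fun p : (Fin n → ℝ) × U => ⨆ w : E, J (f p.1 p.2.1 + w.1)) := by
    refine lowerSemicontinuous_ciSup (fun p => ⟨c, ?_⟩) (fun w => ?_)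
    · rintro _ ⟨v, rfl⟩
      exact (hb _).2
    · refine hJ.comp (g := fun p : (Fin n → ℝ) × U => f p.1 p.2.1 + w.1) ?_
      exact (hf.comp (g := fun p : (Fin n → ℝ) × (Fin m → ℝ) => f p.1 p.2)
        (f := fun p : (Fin n → ℝ) × U => (p.1, p.2.1)) (by fun_prop)).add continuous_const
  obtain ⟨h1, h2⟩ := lsc_min_attained _ hl h0
  refine ⟨h1, h2, fun x => ?_⟩
  obtain ⟨u, hu⟩ := h2 x
  rw [hu]
  exact ⟨h0 (x, u), hc (x, u)⟩

theorem Jaux_props {n m : ℕ}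
    (f : ℕ → (Fin n → ℝ) → (Fin m → ℝ) → (Fin n → ℝ))
    (U : Set (Fin m → ℝ)) (E : Set (Fin n → ℝ)) (T : ℕ → Set (Fin n → ℝ)) (N : ℕ)
    (hU : U.Nonempty) (hUc : IsCompact U) (hE : E.Nonempty)
    (hf : ∀ t, Continuous (fun p : (Fin n → ℝ) × (Fin m → ℝ) => f t p.1 p.2))
    (hT : ∀ t, t ≤ N → IsClosed (T t)) (d : ℕ) :
    LowerSemicontinuous (Jaux f U E T N d) ∧
      ∀ x, 0 ≤ Jaux f U E T N d x ∧ Jaux f U E T N d x ≤ (d : ℝ) + 1 := by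
  induction d with
  | zero =>
    refine ⟨gfun_lsc T N (hT N le_rfl), fun x => ?_⟩
    simpa [Jaux] using gfun_mem T N x
  | succ d ih =>
    obtain ⟨h1, -, h3⟩ := step_aux (f (N - (d + 1))) U E hU hUc hE (hf _) _ ih.1 _ ih.2
    refine ⟨(gfun_lsc T (N - (d + 1)) (hT _ (Nat.sub_le _ _))).add h1, fun x => ?_⟩
    have hg := gfun_mem T (N - (d + 1)) x
    have := h3 x
    simp only [Jaux]
    push_cast
    constructor <;> linarith [hg.1, hg.2, this.1, this.2]

/-- With `U` nonempty compact, `E` nonempty, `f_k` continuous and the target tube closed, every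
min–max value function `J_k` (i) takes values in `[0, N−k+1]`, (ii) is lower semicontinuous, and
(iii) for `k < N` the infimum over `u ∈ U` in its definition is attained. -/
theorem minmax_value_functions_lsc {n m : ℕ}
    (f : ℕ → (Fin n → ℝ) → (Fin m → ℝ) → (Fin n → ℝ))
    (U : Set (Fin m → ℝ)) (E : Set (Fin n → ℝ)) (T : ℕ → Set (Fin n → ℝ)) (N : ℕ)
    (hU : U.Nonempty) (hUc : IsCompact U) (hE : E.Nonempty)
    (hf : ∀ t, Continuous (fun p : (Fin n → ℝ) × (Fin m → ℝ) => f t p.1 p.2))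
    (hT : ∀ t, t ≤ N → IsClosed (T t)) :
    ∀ k, k ≤ N →
      (∀ x, Jval f U E T N k x ∈ Set.Icc (0 : ℝ) ((N : ℝ) - (k : ℝ) + 1)) ∧
      LowerSemicontinuous (Jval f U E T N k) ∧
      (k < N → ∀ x, ∃ u ∈ U,
        Jval f U E T N k x =
          gfun T k x + ⨆ w : E, Jval f U E T N (k + 1) (f k x u + w.1)) := by
  intro k hk
  obtain ⟨h1, h2⟩ := Jaux_props f U E T N hU hUc hE hf hT (N - k)
  refine ⟨fun x => ?_, h1, fun hkN x => ?_⟩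
  · have := h2 x
    rw [Nat.cast_sub hk] at this
    exact this
  · obtain ⟨g1, g2⟩ := Jaux_props f U E T N hU hUc hE hf hT (N - (k + 1))
    obtain ⟨-, h, -⟩ := step_aux (f k) U E hU hUc hE (hf _) _ g1 _ g2
    obtain ⟨u, hu⟩ := h x
    refine ⟨u.1, u.2, ?_⟩
    unfold Jval
    rw [← hu]
    have e : N - k = (N - (k + 1)) + 1 := by omega
    have e2 : N - (N - (k + 1) + 1) = k := by omega
    rw [e]
    simp only [Jaux]
    rw [e2]
end

section
/- Let U ⊆ ℝᵐ be nonempty and compact, E ⊆ ℝⁿ be nonempty, f : ℕ → ℝⁿ → ℝᵐ → ℝⁿ be such that each f_k is continuous on ℝⁿ × ℝᵐ, and T_0,…,T_N ⊆ ℝⁿ be closed sets. With g_k(x) = 0 if x ∈ T_k and 1 otherwise, and the min–max value functions J_N = g_N, J_k(x) = g_k(x) + inf_{u ∈ U} sup_{w ∈ E} J_{k+1}( f_k(x,u) + w ) for k < N, the disturbance minimal reach set at time 0 equals the zero level set of J_0: R̲_0(E) = { x ∈ ℝⁿ : J_0(x) = 0 }. -/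
open scoped Classical

theorem gfun_cases {n : ℕ} (T : ℕ → Set (Fin n → ℝ)) (k : ℕ) (x : Fin n → ℝ) :
    (x ∈ T k ∧ gfun T k x = 0) ∨ (x ∉ T k ∧ gfun T k x = 1) := by
  unfold gfun
  by_cases h : x ∈ T k <;> simp [h]

theorem Jaux_props_s7 {n m : ℕ} (f : ℕ → (Fin n → ℝ) → (Fin m → ℝ) → (Fin n → ℝ))
    (U : Set (Fin m → ℝ)) (E : Set (Fin n → ℝ)) (T : ℕ → Set (Fin n → ℝ)) (N : ℕ)
    (hU : U.Nonempty) (hE : E.Nonempty) (d : ℕ) :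
    (∀ x, 0 ≤ Jaux f U E T N d x ∧ Jaux f U E T N d x ≤ d + 1 ∧
      (Jaux f U E T N d x < 1 → Jaux f U E T N d x = 0)) ∧
    ∀ x, (Jaux f U E T N (d + 1) x = 0 ↔ x ∈ T (N - (d + 1)) ∧
      ∃ u ∈ U, ∀ w ∈ E, Jaux f U E T N d (f (N - (d + 1)) x u + w) = 0) := by
  haveI : Nonempty U := hU.to_subtype
  haveI : Nonempty E := hE.to_subtype
  -- facts about one step of the recursion
  have key : ∀ J : (Fin n → ℝ) → ℝ, ∀ C : ℝ,
      (∀ x, 0 ≤ J x ∧ J x ≤ C ∧ (J x < 1 → J x = 0)) → ∀ φ : (Fin m → ℝ) → (Fin n → ℝ),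
      0 ≤ (⨅ u : U, ⨆ w : E, J (φ u.1 + w.1)) ∧
      (⨅ u : U, ⨆ w : E, J (φ u.1 + w.1)) ≤ C ∧
      ((⨅ u : U, ⨆ w : E, J (φ u.1 + w.1)) < 1 → ∃ u ∈ U, ∀ w ∈ E, J (φ u + w) = 0) ∧
      ((∃ u ∈ U, ∀ w ∈ E, J (φ u + w) = 0) → (⨅ u : U, ⨆ w : E, J (φ u.1 + w.1)) = 0) := by
    intro J C hJ φ
    have hb : ∀ u : U, BddAbove (Set.range fun w : E => J (φ u.1 + w.1)) := by
      intro u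
      refine ⟨C, ?_⟩
      rintro _ ⟨w, rfl⟩
      exact (hJ _).2.1
    have h0 : ∀ u : U, 0 ≤ ⨆ w : E, J (φ u.1 + w.1) := fun u =>
      Real.iSup_nonneg fun w => (hJ _).1
    have hbb : BddBelow (Set.range fun u : U => ⨆ w : E, J (φ u.1 + w.1)) := by
      refine ⟨0, ?_⟩
      rintro _ ⟨u, rfl⟩
      exact h0 u
    have hnn : 0 ≤ (⨅ u : U, ⨆ w : E, J (φ u.1 + w.1)) := Real.iInf_nonneg h0
    refine ⟨hnn, ?_, ?_, ?_⟩
    · obtain ⟨u⟩ := ‹Nonempty U›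
      exact (ciInf_le hbb u).trans (ciSup_le fun w => (hJ _).2.1)
    · intro h
      obtain ⟨u, hu⟩ := exists_lt_of_ciInf_lt h
      refine ⟨u.1, u.2, fun w hw => (hJ _).2.2 ?_⟩
      exact (le_ciSup (hb u) ⟨w, hw⟩).trans_lt hu
    · rintro ⟨u, hu, h⟩
      refine le_antisymm ((ciInf_le hbb ⟨u, hu⟩).trans (ciSup_le fun w => ?_)) hnn
      exact (h w.1 w.2).le
  have hA : ∀ d : ℕ, ∀ x, 0 ≤ Jaux f U E T N d x ∧ Jaux f U E T N d x ≤ d + 1 ∧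
      (Jaux f U E T N d x < 1 → Jaux f U E T N d x = 0) := by
    intro d
    induction d with
    | zero =>
      intro x
      simp only [Jaux]
      rcases gfun_cases T N x with ⟨_, h⟩ | ⟨_, h⟩ <;> rw [h] <;> norm_num
    | succ d ih =>
      intro x
      obtain ⟨k1, k2, k3, k4⟩ := key _ _ ih (f (N - (d + 1)) x)
      simp only [Jaux]
      push_cast
      rcases gfun_cases T (N - (d + 1)) x with ⟨_, h⟩ | ⟨_, h⟩
      · rw [h]
        refine ⟨by linarith, by linarith, fun hlt => ?_⟩
        rw [zero_add] at hlt ⊢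
        exact k4 (k3 hlt)
      · rw [h]
        exact ⟨by linarith, by linarith, fun hlt => by linarith⟩
  refine ⟨hA d, fun x => ?_⟩
  obtain ⟨k1, k2, k3, k4⟩ := key _ _ (hA d) (f (N - (d + 1)) x)
  simp only [Jaux]
  rcases gfun_cases T (N - (d + 1)) x with ⟨hx, h⟩ | ⟨hx, h⟩
  · rw [h, zero_add]
    exact ⟨fun h0 => ⟨hx, k3 (by linarith)⟩, fun h0 => k4 h0.2⟩
  · rw [h]
    exact ⟨fun h0 => by linarith, fun h0 => absurd h0.1 hx⟩

/-- With `U` nonempty compact, `E` nonempty, `f_k` continuous and the target tube closed, the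
disturbance minimal reach set at time `0` is exactly the zero level set of the min–max value
function `J_0`: `R̲_0(E) = { x : J_0(x) = 0 }`. -/
theorem reachMin_eq_zero_level_set {n m : ℕ}
    (f : ℕ → (Fin n → ℝ) → (Fin m → ℝ) → (Fin n → ℝ))
    (U : Set (Fin m → ℝ)) (E : Set (Fin n → ℝ)) (T : ℕ → Set (Fin n → ℝ)) (N : ℕ)
    (hU : U.Nonempty) (hUc : IsCompact U) (hE : E.Nonempty)
    (hf : ∀ t, Continuous (fun p : (Fin n → ℝ) × (Fin m → ℝ) => f t p.1 p.2))
    (hT : ∀ t, t ≤ N → IsClosed (T t)) :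
    ReachMin N f U E T 0 = { x | Jval f U E T N 0 x = 0 } := by
  have hB : ∀ t, t < N → ∀ x, (Jaux f U E T N (N - t) x = 0 ↔ x ∈ T t ∧
      ∃ u ∈ U, ∀ w ∈ E, Jaux f U E T N (N - (t + 1)) (f t x u + w) = 0) := by
    intro t ht x
    have h := (Jaux_props_s7 f U E T N hU hE (N - (t + 1))).2 x
    have e1 : N - (t + 1) + 1 = N - t := by omega
    have e2 : N - (N - t) = t := by omega
    rwa [e1, e2] at h
  have hN : ∀ x, (Jaux f U E T N (N - N) x = 0 ↔ x ∈ T N) := by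
    intro x
    rw [Nat.sub_self]
    simp only [Jaux]
    rcases gfun_cases T N x with ⟨hx, h⟩ | ⟨hx, h⟩ <;> simp [h, hx]
  ext x
  simp only [ReachMin, Set.mem_setOf_eq, Jval, Nat.zero_le, true_implies, zero_add]
  constructor
  · rintro ⟨-, ν, hν, hall⟩
    by_contra hne
    have hw : ∀ t z, ∃ w ∈ E, (∃ w' ∈ E, Jaux f U E T N (N - (t + 1)) (f t z (ν t z) + w') ≠ 0) →
        Jaux f U E T N (N - (t + 1)) (f t z (ν t z) + w) ≠ 0 := by
      intro t z
      by_cases h : ∃ w' ∈ E, Jaux f U E T N (N - (t + 1)) (f t z (ν t z) + w') ≠ 0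
      · obtain ⟨w, hw, h'⟩ := h
        exact ⟨w, hw, fun _ => h'⟩
      · obtain ⟨w, hw⟩ := hE
        exact ⟨w, hw, fun h' => absurd h' h⟩
    choose W hWE hW using hw
    -- worst-case closed-loop states
    let y : ℕ → (Fin n → ℝ) := traj (fun t z u => f t z u + W t z) ν 0 0 x
    have hy : ∀ j, traj f ν (fun t => W t (y t)) 0 x j = y j := by
      intro j
      induction j with
      | zero => rfl
      | succ j ih =>
        simp only [traj, ih, y, zero_add, Pi.zero_apply, add_zero]
    have hin : ∀ j, j ≤ N → y j ∈ T j := by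
      intro j hj
      rw [← hy j]
      exact hall _ (fun t _ => hWE _ _) j hj
    have hJ : ∀ j, j ≤ N → Jaux f U E T N (N - j) (y j) ≠ 0 := by
      intro j
      induction j with
      | zero => intro _; exact hne
      | succ j ih =>
        intro hj
        have h1 := ih (by omega)
        have e : y (j + 1) = f j (y j) (ν j (y j)) + W j (y j) := by
          simp only [y, traj, zero_add, Pi.zero_apply, add_zero]
        rw [e]
        apply hW
        by_contra hc
        push Not at hc
        exact h1 ((hB j (by omega) _).2 ⟨hin j (by omega), _, hν _ _, hc⟩)
    exact hJ N le_rfl ((hN _).2 (hin N le_rfl))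
  · intro h0
    have hmem : ∀ t, t ≤ N → ∀ z, Jaux f U E T N (N - t) z = 0 → z ∈ T t := by
      intro t ht z hz
      rcases Nat.lt_or_eq_of_le ht with h | rfl
      · exact ((hB t h z).1 hz).1
      · exact (hN z).1 hz
    have hu : ∀ t z, ∃ u ∈ U,
        (∃ u' ∈ U, ∀ w ∈ E, Jaux f U E T N (N - (t + 1)) (f t z u' + w) = 0) →
        ∀ w ∈ E, Jaux f U E T N (N - (t + 1)) (f t z u + w) = 0 := by
      intro t z
      by_cases h : ∃ u' ∈ U, ∀ w ∈ E, Jaux f U E T N (N - (t + 1)) (f t z u' + w) = 0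
      · obtain ⟨u, hu, h'⟩ := h
        exact ⟨u, hu, fun _ => h'⟩
      · obtain ⟨u, hu⟩ := hU
        exact ⟨u, hu, fun h' => absurd h' h⟩
    choose ν hν hνJ using hu
    refine ⟨hmem 0 (Nat.zero_le _) x h0, ν, hν, fun e he => ?_⟩
    have hJ : ∀ j, j ≤ N → Jaux f U E T N (N - j) (traj f ν e 0 x j) = 0 := by
      intro j
      induction j with
      | zero => intro _; exact h0
      | succ j ih =>
        intro hj
        have h1 := ((hB j (by omega) _).1 (ih (by omega))).2
        simp only [traj, zero_add]
        exact hνJ j _ h1 _ (he j (by omega))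
    exact fun j hj => hmem j hj _ (hJ j hj)
end
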